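/- arXiv:1108.0643 — 2 statements merged into one kernel-verified Lean document; each statement's English description precedes it below -/
import Mathlib

section
/- For every χ ∈ (0,1): (√(2√2+2)/π)·(Γ(3/4)/Γ(1/4))·A(χ) + (2√(1+√2)/π^{3/2})·χ^{−1/2}·B(χ) = √((√2+1)/(2π))·(2−χ)/√χ. -/
/-- `A(χ) := ∫_χ^1 (1−ζ) ζ^{−3/4} (ζ−χ)^{−3/4} dζ`. -/
noncomputable def Aint (χ : ℝ) : ℝ :=
  ∫ ζ in χ..1, (1 - ζ) * ζ ^ (-(3/4) : ℝ) * (ζ - χ) ^ (-(3/4) : ℝ)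

/-- `B(χ) := ∫_{1−χ}^1 ζ^{1/2} (ζ−1+χ)^{−1/4} (1−ζ)^{−1/4} dζ`. -/
noncomputable def Bint (χ : ℝ) : ℝ :=
  ∫ ζ in (1 - χ)..1, ζ ^ ((1/2) : ℝ) * (ζ - 1 + χ) ^ (-(1/4) : ℝ) * (1 - ζ) ^ (-(1/4) : ℝ)

open MeasureTheory Set Filter Topology

theorem beta_intervalIntegrable {a b : ℝ} (ha : -1 < a) (hb : -1 < b) :
    IntervalIntegrable (fun u : ℝ => u ^ a * (1 - u) ^ b) volume 0 1 := by
  have h := Complex.betaIntegral_convergent (u := ((a + 1 : ℝ) : ℂ)) (v := ((b + 1 : ℝ) : ℂ))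
    (by rw [Complex.ofReal_re]; linarith) (by rw [Complex.ofReal_re]; linarith)
  rw [intervalIntegrable_iff] at h ⊢
  refine (integrable_congr ?_).mp h.re
  filter_upwards [ae_restrict_mem measurableSet_uIoc] with u hu
  rw [uIoc_of_le zero_le_one] at hu
  have h1 : (0 : ℝ) ≤ 1 - u := by linarith [hu.2]
  have e : ((u : ℂ) ^ (((a + 1 : ℝ) : ℂ) - 1) * (1 - (u : ℂ)) ^ (((b + 1 : ℝ) : ℂ) - 1))
      = ((u ^ a * (1 - u) ^ b : ℝ) : ℂ) := by
    push_cast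
    rw [Complex.ofReal_cpow hu.1.le, Complex.ofReal_cpow h1]
    push_cast
    ring_nf
  rw [e]
  simp

theorem integral_rpow_mul_one_sub_rpow {a b : ℝ} (ha : -1 < a) (hb : -1 < b) :
    ∫ u in (0 : ℝ)..1, u ^ a * (1 - u) ^ b
      = Real.Gamma (a + 1) * Real.Gamma (b + 1) / Real.Gamma (a + b + 2) := by
  have h := ProbabilityTheory.beta_eq_betaIntegralReal (a + 1) (b + 1) (by linarith) (by linarith)
  have e : Complex.betaIntegral ((a + 1 : ℝ) : ℂ) ((b + 1 : ℝ) : ℂ)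
      = ((∫ u in (0 : ℝ)..1, u ^ a * (1 - u) ^ b : ℝ) : ℂ) := by
    rw [Complex.betaIntegral, ← intervalIntegral.integral_ofReal]
    refine intervalIntegral.integral_congr fun u hu => ?_
    rw [uIcc_of_le zero_le_one] at hu
    have h1 : (0 : ℝ) ≤ 1 - u := by linarith [hu.2]
    push_cast
    rw [Complex.ofReal_cpow hu.1, Complex.ofReal_cpow h1]
    push_cast
    ring_nf
  rw [e, Complex.ofReal_re, ProbabilityTheory.beta] at h
  rw [← h]
  ring_nf

/-- The unnormalised incomplete integral `√χ · A(χ)`, after the substitution `ζ = χ / s`. -/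
noncomputable def incompleteA (χ : ℝ) : ℝ :=
  ∫ s in χ..1, (s - χ) * (s ^ (-(3/2) : ℝ) * (1 - s) ^ (-(3/4) : ℝ))

theorem incompleteA_one : incompleteA 1 = 0 := by simp [incompleteA]

theorem Aint_eq {χ : ℝ} (hχ : χ ∈ Ioo (0 : ℝ) 1) :
    Aint χ = χ ^ (-(1/2) : ℝ) * incompleteA χ := by
  obtain ⟨h0, h1⟩ := hχ
  have himg : (fun s : ℝ => χ / s) '' Ioo χ 1 = Ioo χ 1 := by
    ext z
    constructor
    · rintro ⟨s, ⟨hs0, hs1⟩, rfl⟩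
      have hs : 0 < s := h0.trans hs0
      exact ⟨(lt_div_iff₀ hs).2 (by nlinarith), (div_lt_one hs).2 hs0⟩
    · rintro ⟨hz0, hz1⟩
      have hz : 0 < z := h0.trans hz0
      exact ⟨χ / z, ⟨(lt_div_iff₀ hz).2 (by nlinarith), (div_lt_one hz).2 hz0⟩, by field_simp⟩
  have key := integral_image_eq_integral_abs_deriv_smul (s := Ioo χ 1)
    (f := fun s : ℝ => χ / s) (f' := fun s => -χ / s ^ 2) measurableSet_Ioo
    (fun s hs => by
      have hs0 : s ≠ 0 := (h0.trans hs.1).ne'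
      have := ((hasDerivAt_const s χ).div (hasDerivAt_id s) hs0).hasDerivWithinAt (s := Ioo χ 1)
      convert! this using 1
      simp)
    (fun s hs t ht hst => by
      have hs0 : s ≠ 0 := (h0.trans hs.1).ne'
      have ht0 : t ≠ 0 := (h0.trans ht.1).ne'
      have : χ / s = χ / t := hst
      field_simp at this
      exact this.symm)
    (fun ζ => (1 - ζ) * ζ ^ (-(3/4) : ℝ) * (ζ - χ) ^ (-(3/4) : ℝ))
  rw [himg] at key
  rw [Aint, incompleteA, intervalIntegral.integral_of_le h1.le,
    intervalIntegral.integral_of_le h1.le, integral_Ioc_eq_integral_Ioo,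
    integral_Ioc_eq_integral_Ioo, key, ← integral_const_mul]
  refine setIntegral_congr_fun measurableSet_Ioo fun s hs => ?_
  have hs0 : 0 < s := h0.trans hs.1
  have hs1 : 0 < 1 - s := by linarith [hs.2]
  have e1 : χ / s - χ = χ * (1 - s) * s⁻¹ := by field_simp
  have e2 : |-χ / s ^ 2| = χ * (s⁻¹) ^ 2 := by
    rw [abs_div, abs_neg, abs_of_pos h0, abs_of_pos (by positivity)]; field_simp
  have e3 : (s⁻¹ : ℝ) ^ (-(3/4) : ℝ) = s ^ ((3/4) : ℝ) := by
    rw [Real.inv_rpow hs0.le, Real.rpow_neg hs0.le, inv_inv]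
  simp only [smul_eq_mul]
  rw [e1, e2, div_eq_mul_inv, Real.mul_rpow h0.le (by positivity),
    Real.mul_rpow (by positivity) (by positivity), Real.mul_rpow h0.le hs1.le, e3]
  have f1 : χ ^ (-(3/4) : ℝ) * χ ^ (-(3/4) : ℝ) * χ = χ ^ (-(1/2) : ℝ) := by
    rw [← Real.rpow_add h0, ← Real.rpow_add_one h0.ne']; norm_num
  have f2 : s ^ ((3/4) : ℝ) * s ^ ((3/4) : ℝ) = s ^ (-(3/2) : ℝ) * s ^ 3 := by
    rw [← Real.rpow_add hs0, ← Real.rpow_natCast, ← Real.rpow_add hs0]; norm_num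
  rw [← f1]
  calc _ = (χ ^ (-(3/4) : ℝ) * χ ^ (-(3/4) : ℝ) * χ) * (1 - s) ^ (-(3/4) : ℝ)
        * (s⁻¹ ^ 2 * (1 - χ * s⁻¹)) * (s ^ ((3/4) : ℝ) * s ^ ((3/4) : ℝ)) := by ring
    _ = _ := by rw [f2]; field_simp

theorem rpow_mul_one_sub_rpow_intervalIntegrable {a b χ : ℝ} (hb : -1 < b)
    (hχ : χ ∈ Ioo (0 : ℝ) 1) :
    IntervalIntegrable (fun s : ℝ => s ^ a * (1 - s) ^ b) volume χ 1 := by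
  have h := (intervalIntegral.intervalIntegrable_rpow' (a := 1 - χ) (b := 0) hb).comp_sub_left 1
  simp only [sub_sub_cancel, sub_zero] at h
  refine h.continuousOn_mul ?_
  refine continuousOn_id.rpow_const fun s hs => Or.inl ?_
  rw [uIcc_of_le hχ.2.le] at hs
  exact (hχ.1.trans_le hs.1).ne'

theorem hasDerivAt_incompleteA {χ : ℝ} (hχ : χ ∈ Ioo (0 : ℝ) 1) :
    HasDerivAt incompleteA (-∫ s in χ..1, s ^ (-(3/2) : ℝ) * (1 - s) ^ (-(3/4) : ℝ)) χ := by
  set k : ℝ → ℝ := fun s => s ^ (-(3/2) : ℝ) * (1 - s) ^ (-(3/4) : ℝ) with hk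
  have hint : ∀ y ∈ Ioo (0 : ℝ) 1, IntervalIntegrable k volume y 1 := fun y hy =>
    rpow_mul_one_sub_rpow_intervalIntegrable (by norm_num) hy
  have hint' : ∀ y ∈ Ioo (0 : ℝ) 1, IntervalIntegrable (fun s => s * k s) volume y 1 :=
    fun y hy => (hint y hy).continuousOn_mul continuousOn_id
  have hmeas : Measurable k := by fun_prop
  have hcont : ContinuousAt k χ :=
    (continuousAt_id.rpow_const (Or.inl hχ.1.ne')).mul
      ((continuousAt_const.sub continuousAt_id).rpow_const
        (Or.inl (by simpa using (sub_pos.2 hχ.2).ne')))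
  have d1 := intervalIntegral.integral_hasDerivAt_left (hint χ hχ)
    hmeas.stronglyMeasurable.stronglyMeasurableAtFilter hcont
  have d2 := intervalIntegral.integral_hasDerivAt_left (hint' χ hχ)
    (measurable_id.mul hmeas).stronglyMeasurable.stronglyMeasurableAtFilter
    (continuousAt_id.mul hcont)
  have d := d2.sub ((hasDerivAt_id χ).mul d1)
  refine (d.congr_of_eventuallyEq ?_).congr_deriv ?_
  · filter_upwards [isOpen_Ioo.mem_nhds hχ] with y hy
    simp only [incompleteA, Pi.sub_apply, Pi.mul_apply, id]
    rw [← intervalIntegral.integral_const_mul, ← intervalIntegral.integral_sub (hint' y hy)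
      ((hint y hy).const_mul y)]
    simp only [sub_mul, hk]
  · simp

theorem wronskian_incompleteA {χ : ℝ} (hχ : χ ∈ Ioo (0 : ℝ) 1) :
    (2 - χ) * (-∫ s in χ..1, s ^ (-(3/2) : ℝ) * (1 - s) ^ (-(3/4) : ℝ)) + incompleteA χ
      = -4 * (χ ^ (-(1/2) : ℝ) * (1 - χ) ^ (1/4 : ℝ)) := by
  have hint := rpow_mul_one_sub_rpow_intervalIntegrable (a := -(3/2)) (b := -(3/4))
    (by norm_num) hχ
  have hftc := intervalIntegral.integral_eq_sub_of_hasDerivAt_of_le (a := χ) (b := 1)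
    (f := fun s : ℝ => 4 * (s ^ (-(1/2) : ℝ) * (1 - s) ^ (1/4 : ℝ)))
    (f' := fun s : ℝ => (s - 2) * (s ^ (-(3/2) : ℝ) * (1 - s) ^ (-(3/4) : ℝ))) hχ.2.le
    (by
      refine continuousOn_const.mul ((continuousOn_id.rpow_const fun s hs =>
        Or.inl (hχ.1.trans_le hs.1).ne').mul ?_)
      exact ((continuousOn_const.sub continuousOn_id).rpow_const fun s hs => Or.inr (by norm_num)))
    (fun s hs => by
      have hs0 : 0 < s := hχ.1.trans hs.1
      have hs1 : 0 < 1 - s := by linarith [hs.2]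
      have d := (((hasDerivAt_id s).rpow_const (p := -(1/2)) (Or.inl hs0.ne')).mul
        (((hasDerivAt_id s).const_sub 1).rpow_const (p := 1/4) (Or.inl hs1.ne'))).const_mul 4
      refine d.congr_deriv ?_
      simp only [id]
      have f1 : s ^ (-(1/2) : ℝ) = s ^ (-(3/2) : ℝ) * s := by
        rw [← Real.rpow_add_one hs0.ne']; norm_num
      have f2 : (1 - s) ^ (1/4 : ℝ) = (1 - s) ^ (-(3/4) : ℝ) * (1 - s) := by
        rw [← Real.rpow_add_one hs1.ne']; norm_num
      rw [f1, f2, show (-(1/2) - 1 : ℝ) = -(3/2) by norm_num,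
        show (1/4 - 1 : ℝ) = -(3/4) by norm_num]
      ring)
    (hint.continuousOn_mul (by fun_prop))
  have hz : (1 - 1 : ℝ) ^ (1/4 : ℝ) = 0 := by norm_num
  rw [hz, mul_zero, mul_zero, zero_sub] at hftc
  rw [neg_mul, ← hftc, incompleteA, mul_neg, ← neg_mul,
    ← intervalIntegral.integral_const_mul,
    ← intervalIntegral.integral_add (hint.const_mul _) (hint.continuousOn_mul (by fun_prop))]
  congr 1
  ext s
  ring

theorem incompleteA_eq_integral_max {χ : ℝ} (hχ : χ ∈ Icc (0 : ℝ) 1) :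
    incompleteA χ
      = ∫ s in (0 : ℝ)..1, max (s - χ) 0 * (s ^ (-(3/2) : ℝ) * (1 - s) ^ (-(3/4) : ℝ)) := by
  rw [incompleteA, intervalIntegral.integral_of_le hχ.2, intervalIntegral.integral_of_le zero_le_one]
  symm
  calc _ = ∫ s in Ioc χ 1, max (s - χ) 0 * (s ^ (-(3/2) : ℝ) * (1 - s) ^ (-(3/4) : ℝ)) := by
        refine setIntegral_eq_of_subset_of_forall_sdiff_eq_zero measurableSet_Ioc
          (Ioc_subset_Ioc_left hχ.1) fun s hs => ?_
        have : s ≤ χ := by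
          by_contra! h
          exact hs.2 ⟨h, hs.1.2⟩
        rw [max_eq_right (by linarith), zero_mul]
    _ = _ := by
        refine setIntegral_congr_fun measurableSet_Ioc fun s hs => ?_
        rw [max_eq_left (by linarith [hs.1])]

theorem continuousOn_incompleteA : ContinuousOn incompleteA (Icc 0 1) := by
  refine ContinuousOn.congr ?_ fun χ hχ => incompleteA_eq_integral_max hχ
  simp only [intervalIntegral.integral_of_le zero_le_one]
  have hb := beta_intervalIntegrable (a := -(1/2)) (b := -(3/4)) (by norm_num) (by norm_num)
  rw [intervalIntegrable_iff, uIoc_of_le zero_le_one] at hb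
  refine continuousOn_of_dominated (fun χ _ => ?_) (fun χ hχ => ?_) hb ?_
  · exact Measurable.aestronglyMeasurable (by fun_prop)
  · filter_upwards [ae_restrict_mem measurableSet_Ioc] with s hs
    have hs1 : 0 ≤ 1 - s := by linarith [hs.2]
    have f1 : s ^ (-(1/2) : ℝ) = s * s ^ (-(3/2) : ℝ) := by
      rw [mul_comm, ← Real.rpow_add_one hs.1.ne']; norm_num
    have hs0 := hs.1
    rw [Real.norm_of_nonneg (by positivity), f1, mul_assoc]
    gcongr
    exact max_le (by linarith [hχ.1]) hs0.le
  · exact Eventually.of_forall fun s => by fun_prop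

theorem incompleteA_zero :
    incompleteA 0 = Real.Gamma (1/2) * Real.Gamma (1/4) / Real.Gamma (3/4) := by
  have h := integral_rpow_mul_one_sub_rpow (a := -(1/2)) (b := -(3/4)) (by norm_num) (by norm_num)
  norm_num at h
  rw [incompleteA]
  norm_num
  rw [← h, intervalIntegral.integral_of_le zero_le_one, intervalIntegral.integral_of_le zero_le_one]
  refine setIntegral_congr_fun measurableSet_Ioc fun s hs => ?_
  rw [← mul_assoc, mul_comm s, ← Real.rpow_add_one hs.1.ne']
  norm_num

theorem rpow_le_one_add_rpow {δ y : ℝ} (hδ : 0 < δ) (hy : δ ≤ y) (hy1 : y ≤ 1) (q : ℝ) :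
    y ^ q ≤ 1 + δ ^ q := by
  have hy0 := hδ.trans_le hy
  rcases le_total 0 q with hq | hq
  · exact (Real.rpow_le_one hy0.le hy1 hq).trans (by linarith [Real.rpow_pos_of_pos hδ q])
  · exact (Real.rpow_le_rpow_of_nonpos hδ hy hq).trans (by linarith)

/-- Differentiation of Euler-type integrals under the integral sign. -/
theorem hasDerivAt_integral_one_sub_mul_rpow {ψ : ℝ → ℝ} (hψ : IntervalIntegrable ψ volume 0 1)
    (p : ℝ) {χ : ℝ} (hχ : χ ∈ Ioo (0 : ℝ) 1) :
    IntervalIntegrable (fun u => (1 - χ * u) ^ (p - 1) * (u * ψ u)) volume 0 1 ∧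
    HasDerivAt (fun x => ∫ u in (0 : ℝ)..1, (1 - x * u) ^ p * ψ u)
      (-p * ∫ u in (0 : ℝ)..1, (1 - χ * u) ^ (p - 1) * (u * ψ u)) χ := by
  obtain ⟨h0, h1⟩ := hχ
  have hpos : ∀ x ∈ Ioo 0 ((1 + χ) / 2), ∀ u ∈ Icc (0 : ℝ) 1,
      (1 - χ) / 2 ≤ 1 - x * u ∧ 1 - x * u ≤ 1 := fun x hx u hu =>
    ⟨by nlinarith [hx.1, hx.2, hu.1, hu.2], by nlinarith [hx.1, hx.2, hu.1, hu.2]⟩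
  have hδ : 0 < (1 - χ) / 2 := by linarith
  have hs : Ioo 0 ((1 + χ) / 2) ∈ 𝓝 χ := isOpen_Ioo.mem_nhds ⟨h0, by linarith⟩
  have hcont : ∀ x ∈ Ioo 0 ((1 + χ) / 2), ∀ q : ℝ,
      ContinuousOn (fun u => (1 - x * u) ^ q) (uIcc 0 1) := fun x hx q => by
    refine ContinuousOn.rpow_const (by fun_prop) fun u hu => Or.inl ?_
    rw [uIcc_of_le zero_le_one] at hu
    exact (hδ.trans_le (hpos x hx u hu).1).ne'
  have hχ : χ ∈ Ioo 0 ((1 + χ) / 2) := ⟨h0, by linarith⟩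
  have hint : IntervalIntegrable (fun u => (1 - χ * u) ^ (p - 1) * (u * ψ u)) volume 0 1 :=
    (hψ.continuousOn_mul continuousOn_id).continuousOn_mul (hcont χ hχ _)
  have hint' : IntervalIntegrable (fun u => -p * ((1 - χ * u) ^ (p - 1) * (u * ψ u))) volume 0 1 :=
    hint.const_mul _
  refine ⟨hint, ?_⟩
  rw [← intervalIntegral.integral_const_mul]
  refine (intervalIntegral.hasDerivAt_integral_of_dominated_loc_of_deriv_le
    (F := fun x u => (1 - x * u) ^ p * ψ u)
    (F' := fun x u => -p * ((1 - x * u) ^ (p - 1) * (u * ψ u)))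
    (bound := fun u => |p| * ((1 + ((1 - χ) / 2) ^ (p - 1)) * ‖ψ u‖)) hs ?_
    (hψ.continuousOn_mul (hcont χ hχ p)) hint'.def'.aestronglyMeasurable ?_
    ((hψ.norm.const_mul _).const_mul _) ?_).2
  · filter_upwards [hs] with x hx
    exact (hψ.continuousOn_mul (hcont x hx p)).def'.aestronglyMeasurable
  · refine Eventually.of_forall fun u hu x hx => ?_
    rw [uIoc_of_le zero_le_one] at hu
    obtain ⟨hl, hr⟩ := hpos x hx u ⟨hu.1.le, hu.2⟩
    have hq : 0 ≤ (1 - x * u) ^ (p - 1) := Real.rpow_nonneg (hδ.le.trans hl) _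
    rw [norm_mul, norm_mul, norm_mul, norm_neg, Real.norm_eq_abs p, Real.norm_of_nonneg hq,
      Real.norm_of_nonneg hu.1.le]
    gcongr
    · exact mul_nonneg hu.1.le (norm_nonneg _)
    · exact rpow_le_one_add_rpow hδ hl hr _
    · exact mul_le_of_le_one_left (norm_nonneg _) hu.2
  · refine Eventually.of_forall fun u hu x hx => ?_
    rw [uIoc_of_le zero_le_one] at hu
    have hne := (hδ.trans_le (hpos x hx u ⟨hu.1.le, hu.2⟩).1).ne'
    have d := ((((hasDerivAt_id x).mul_const u).const_sub 1).rpow_const (p := p)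
      (Or.inl hne)).mul_const (ψ u)
    refine d.congr_deriv ?_
    simp only [id]
    ring

/-- The hypergeometric integral `χ ^ (-1/2) * B(χ)`, after the substitution `ζ = 1 - χ u`. -/
noncomputable def eulerB (χ : ℝ) : ℝ :=
  ∫ u in (0 : ℝ)..1, (1 - χ * u) ^ (1/2 : ℝ) * (u ^ (-(1/4) : ℝ) * (1 - u) ^ (-(1/4) : ℝ))

theorem Bint_eq {χ : ℝ} (hχ : χ ∈ Ioo (0 : ℝ) 1) :
    Bint χ = √χ * eulerB χ := by
  obtain ⟨h0, h1⟩ := hχ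
  have h := intervalIntegral.integral_comp_sub_mul (a := 0) (b := 1)
    (fun ζ : ℝ => ζ ^ ((1/2) : ℝ) * (ζ - 1 + χ) ^ (-(1/4) : ℝ) * (1 - ζ) ^ (-(1/4) : ℝ)) h0.ne' 1
  simp only [mul_one, mul_zero, sub_zero, smul_eq_mul] at h
  rw [Bint, eq_comm, ← mul_right_inj' (inv_ne_zero h0.ne'), ← h, eulerB, ← mul_assoc,
    ← intervalIntegral.integral_const_mul]
  refine intervalIntegral.integral_congr fun u hu => ?_
  rw [uIcc_of_le zero_le_one] at hu
  have hu1 : 0 ≤ 1 - u := by linarith [hu.2]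
  have f : χ⁻¹ * √χ = χ ^ (-(1/4) : ℝ) * χ ^ (-(1/4) : ℝ) := by
    rw [← Real.rpow_add h0, Real.sqrt_eq_rpow, ← Real.rpow_neg_one, ← Real.rpow_add h0]
    norm_num
  rw [show 1 - χ * u - 1 + χ = χ * (1 - u) by ring, show 1 - (1 - χ * u) = χ * u by ring,
    Real.mul_rpow h0.le hu1, Real.mul_rpow h0.le hu.1, f]
  ring

theorem eulerB_one : eulerB 1 = Real.Gamma (3/4) * Real.Gamma (5/4) := by
  have h := integral_rpow_mul_one_sub_rpow (a := -(1/4)) (b := 1/4) (by norm_num) (by norm_num)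
  norm_num at h
  rw [← h, eulerB, intervalIntegral.integral_of_le zero_le_one,
    intervalIntegral.integral_of_le zero_le_one, integral_Ioc_eq_integral_Ioo,
    integral_Ioc_eq_integral_Ioo]
  refine setIntegral_congr_fun measurableSet_Ioo fun u hu => ?_
  have hu1 : 0 < 1 - u := by linarith [hu.2]
  simp only [one_mul]
  rw [mul_left_comm, ← Real.rpow_add hu1]
  norm_num

theorem continuousOn_eulerB : ContinuousOn eulerB (Icc 0 1) := by
  unfold eulerB
  simp only [intervalIntegral.integral_of_le zero_le_one]
  have hb := beta_intervalIntegrable (a := -(1/4)) (b := -(1/4)) (by norm_num) (by norm_num)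
  rw [intervalIntegrable_iff, uIoc_of_le zero_le_one] at hb
  refine continuousOn_of_dominated (fun χ _ => ?_) (fun χ hχ => ?_) hb ?_
  · exact Measurable.aestronglyMeasurable (by fun_prop)
  · filter_upwards [ae_restrict_mem measurableSet_Ioc] with u hu
    have hu0 := hu.1
    have hu1 : 0 ≤ 1 - u := by linarith [hu.2]
    have hl : 0 ≤ 1 - χ * u := by nlinarith [hχ.1, hχ.2, hu.2]
    rw [Real.norm_of_nonneg (by positivity)]
    exact mul_le_of_le_one_left (by positivity)
      (Real.rpow_le_one hl (by nlinarith [hχ.1]) (by norm_num))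
  · exact Eventually.of_forall fun u =>
      ((Continuous.rpow_const (by fun_prop) fun χ => Or.inr (by norm_num)).mul
        continuous_const).continuousOn

/-- The Wronskian of `√χ * eulerB χ` with the elementary solution `2 - χ`, up to a constant. -/
theorem exists_wronskian_eulerB : ∃ C : ℝ, ∀ χ ∈ Ioo (0 : ℝ) 1, ∃ D : ℝ, HasDerivAt eulerB D χ ∧
    (1 + χ / 2) * eulerB χ + (2 - χ) * χ * D = C * (1 - χ) ^ (1/4 : ℝ) := by
  set φ : ℝ → ℝ := fun u => u ^ (-(1/4) : ℝ) * (1 - u) ^ (-(1/4) : ℝ) with hφdef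
  have hφ : IntervalIntegrable φ volume 0 1 :=
    beta_intervalIntegrable (by norm_num) (by norm_num)
  have hφ1 : IntervalIntegrable (fun u => u * φ u) volume 0 1 :=
    hφ.continuousOn_mul continuousOn_id
  set H1 : ℝ → ℝ := fun χ => ∫ u in (0 : ℝ)..1, (1 - χ * u) ^ (-(1/2) : ℝ) * (u * φ u) with hH1
  set H2 : ℝ → ℝ := fun χ => ∫ u in (0 : ℝ)..1, (1 - χ * u) ^ (-(3/2) : ℝ) * (u * (u * φ u))
    with hH2
  have d0 : ∀ χ ∈ Ioo (0 : ℝ) 1, IntervalIntegrable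
      (fun u => (1 - χ * u) ^ (-(1/2) : ℝ) * (u * φ u)) volume 0 1 ∧
      HasDerivAt eulerB (-(1/2) * H1 χ) χ := fun χ hχ => by
    have := hasDerivAt_integral_one_sub_mul_rpow hφ (1/2) hχ
    rwa [show (1/2 - 1 : ℝ) = -(1/2) by norm_num] at this
  have d1 : ∀ χ ∈ Ioo (0 : ℝ) 1, IntervalIntegrable
      (fun u => (1 - χ * u) ^ (-(3/2) : ℝ) * (u * (u * φ u))) volume 0 1 ∧
      HasDerivAt H1 (1/2 * H2 χ) χ := fun χ hχ => by
    have := hasDerivAt_integral_one_sub_mul_rpow hφ1 (-(1/2)) hχ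
    rwa [show (-(1/2) - 1 : ℝ) = -(3/2) by norm_num, neg_neg] at this
  have ode : ∀ χ ∈ Ioo (0 : ℝ) 1,
      -(χ * (1 - χ) / 4) * H2 χ - (3/4 - 5 * χ / 8) * H1 χ + 3/8 * eulerB χ = 0 := by
    intro χ hχ
    have hpos : ∀ u ∈ Icc (0 : ℝ) 1, 0 < 1 - χ * u := fun u hu => by
      nlinarith [hχ.1, hχ.2, hu.1, hu.2]
    have hi0 : IntervalIntegrable (fun u => (1 - χ * u) ^ (1/2 : ℝ) * φ u) volume 0 1 :=
      hφ.continuousOn_mul (Continuous.continuousOn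
        (Continuous.rpow_const (by fun_prop) fun _ => Or.inr (by norm_num)))
    have hi := (((d1 χ hχ).1.const_mul (-(χ * (1 - χ) / 4))).sub
      ((d0 χ hχ).1.const_mul (3/4 - 5 * χ / 8))).add (hi0.const_mul (3/8))
    have hftc := intervalIntegral.integral_eq_sub_of_hasDerivAt_of_le (a := 0) (b := 1)
      (f := fun u : ℝ =>
        1/2 * (u ^ (3/4 : ℝ) * (1 - u) ^ (3/4 : ℝ) * (1 - χ * u) ^ (-(1/2) : ℝ)))
      zero_le_one
      (by
        refine continuousOn_const.mul (ContinuousOn.mul (Continuous.continuousOn ?_) ?_)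
        · exact (Continuous.rpow_const (by fun_prop) fun _ => Or.inr (by norm_num)).mul
            (Continuous.rpow_const (by fun_prop) fun _ => Or.inr (by norm_num))
        · exact ContinuousOn.rpow_const (by fun_prop) fun u hu => Or.inl (hpos u hu).ne')
      (fun u hu => by
        have hu0 := hu.1
        have hu1 : 0 < 1 - u := by linarith [hu.2]
        have hp := hpos u (Ioo_subset_Icc_self hu)
        have d := ((((hasDerivAt_id u).rpow_const (p := 3/4) (Or.inl hu0.ne')).mul
          (((hasDerivAt_id u).const_sub 1).rpow_const (p := 3/4) (Or.inl hu1.ne'))).mul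
          ((((hasDerivAt_id u).const_mul χ).const_sub 1).rpow_const (p := -(1/2))
            (Or.inl hp.ne'))).const_mul (1/2)
        refine d.congr_deriv ?_
        have f1 : u ^ (3/4 : ℝ) = u ^ (-(1/4) : ℝ) * u := by
          rw [← Real.rpow_add_one hu0.ne']; norm_num
        have f2 : (1 - u) ^ (3/4 : ℝ) = (1 - u) ^ (-(1/4) : ℝ) * (1 - u) := by
          rw [← Real.rpow_add_one hu1.ne']; norm_num
        have f3 : (1 - χ * u) ^ (-(1/2) : ℝ) = (1 - χ * u) ^ (-(3/2) : ℝ) * (1 - χ * u) := by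
          rw [← Real.rpow_add_one hp.ne']; norm_num
        have f4 : (1 - χ * u) ^ (1/2 : ℝ) = (1 - χ * u) ^ (-(3/2) : ℝ) * (1 - χ * u) ^ 2 := by
          rw [← Real.rpow_natCast, ← Real.rpow_add hp]; norm_num
        simp only [id, Pi.mul_apply, hφdef]
        rw [show (3/4 - 1 : ℝ) = -(1/4) by norm_num, show (-(1/2) - 1 : ℝ) = -(3/2) by norm_num,
          f1, f2, f3, f4]
        ring)
      hi
    have hz : (0 : ℝ) ^ (3/4 : ℝ) = 0 := by norm_num
    simp only [sub_self, hz, mul_zero, zero_mul] at hftc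
    rw [← hftc, hH1, hH2, eulerB, ← intervalIntegral.integral_const_mul,
      ← intervalIntegral.integral_const_mul, ← intervalIntegral.integral_const_mul,
      ← intervalIntegral.integral_sub ((d1 χ hχ).1.const_mul _) ((d0 χ hχ).1.const_mul _),
      ← intervalIntegral.integral_add
        (((d1 χ hχ).1.const_mul _).sub ((d0 χ hχ).1.const_mul _)) (hi0.const_mul _)]
  have dZ : ∀ χ ∈ Ioo (0 : ℝ) 1, HasDerivAt (fun x =>
      ((1 + x / 2) * eulerB x + (2 - x) * x * (-(1/2) * H1 x)) * (1 - x) ^ (-(1/4) : ℝ)) 0 χ := by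
    intro χ hχ
    have h1 : 0 < 1 - χ := by linarith [hχ.2]
    have d := (((((hasDerivAt_id χ).div_const 2).const_add 1).mul (d0 χ hχ).2).add
      ((((hasDerivAt_id χ).const_sub 2).mul (hasDerivAt_id χ)).mul
        ((d1 χ hχ).2.const_mul (-(1/2))))).mul
      (((hasDerivAt_id χ).const_sub 1).rpow_const (p := -(1/4)) (Or.inl h1.ne'))
    refine d.congr_deriv ?_
    have f : (1 - χ) ^ (-(1/4) : ℝ) = (1 - χ) ^ (-(1/4) - 1 : ℝ) * (1 - χ) := by
      rw [← Real.rpow_add_one h1.ne']; norm_num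
    simp only [id, Pi.add_apply, Pi.mul_apply]
    rw [f]
    linear_combination (1 - χ) ^ (-(1/4) - 1 : ℝ) * (2 - χ) * ode χ hχ
  obtain ⟨C, hC⟩ := isOpen_Ioo.exists_is_const_of_deriv_eq_zero isPreconnected_Ioo
    (fun χ hχ => (dZ χ hχ).differentiableAt.differentiableWithinAt) (fun χ hχ => (dZ χ hχ).deriv)
  refine ⟨C, fun χ hχ => ⟨_, (d0 χ hχ).2, ?_⟩⟩
  have h1 : 0 < 1 - χ := by linarith [hχ.2]
  rw [← hC χ hχ, mul_assoc _ (_ ^ _), ← Real.rpow_add h1]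
  norm_num

/-- A function on `[0, 1]` vanishing at both ends, whose derivative is a constant multiple of a
positive function, is zero. -/
theorem eq_zero_of_hasDerivAt_const_mul {E w : ℝ → ℝ} {K : ℝ} (hE : ContinuousOn E (Icc 0 1))
    (hE' : ∀ x ∈ Ioo (0 : ℝ) 1, HasDerivAt E (K * w x) x) (hw : ∀ x ∈ Ioo (0 : ℝ) 1, 0 < w x)
    (h0 : E 0 = 0) (h1 : E 1 = 0) {x : ℝ} (hx : x ∈ Ioo (0 : ℝ) 1) : E x = 0 := by
  obtain ⟨c, hc, hc0⟩ := exists_hasDerivAt_eq_zero zero_lt_one hE (h0.trans h1.symm) hE'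
  have hK : K = 0 := (mul_eq_zero.1 hc0).resolve_right (hw c hc).ne'
  obtain ⟨d, hd, hd0⟩ := exists_hasDerivAt_eq_slope E (fun y => K * w y) hx.1
    (hE.mono (Icc_subset_Icc_right hx.2.le)) fun y hy => hE' y ⟨hy.1, hy.2.trans hx.2⟩
  rw [hK, zero_mul, h0, sub_zero, sub_zero, eq_comm, div_eq_zero_iff] at hd0
  exact hd0.resolve_right hx.1.ne'

/-- The connection formula between the two integrals, with constants fixed by the values at the
end points. -/
theorem incompleteA_add_eulerB {α β γ : ℝ} (h0 : α * incompleteA 0 = 2 * γ)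
    (h1 : β * eulerB 1 = γ) {χ : ℝ} (hχ : χ ∈ Ioo (0 : ℝ) 1) :
    α * incompleteA χ + β * (√χ * eulerB χ) = γ * (2 - χ) := by
  obtain ⟨C, hC⟩ := exists_wronskian_eulerB
  have hne : ∀ x ∈ Icc (0 : ℝ) 1, 2 - x ≠ 0 := fun x hx => by linarith [hx.2]
  have key := eq_zero_of_hasDerivAt_const_mul
    (E := fun x => (α * incompleteA x + β * (√x * eulerB x)) / (2 - x) - γ)
    (w := fun x => x ^ (-(1/2) : ℝ) * (1 - x) ^ (1/4 : ℝ) / (2 - x) ^ 2)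
    (K := -4 * α + β * C)
    ((((continuousOn_incompleteA.const_mul α).add
      ((Real.continuous_sqrt.continuousOn.mul continuousOn_eulerB).const_mul β)).div
      (by fun_prop) hne).sub continuousOn_const)
    (fun x hx => by
      obtain ⟨D, hD, hW⟩ := hC x hx
      have hx0 := hx.1
      have d := ((((hasDerivAt_incompleteA hx).const_mul α).add
        (((Real.hasDerivAt_sqrt hx0.ne').mul hD).const_mul β)).div
        ((hasDerivAt_id x).const_sub 2) (hne x (Ioo_subset_Icc_self hx))).sub_const γ
      refine d.congr_deriv ?_
      have hA := wronskian_incompleteA hx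
      have hs : x ^ (-(1/2) : ℝ) = (√x)⁻¹ := by rw [Real.rpow_neg hx0.le, Real.sqrt_eq_rpow]
      have hsp : 0 < √x := Real.sqrt_pos.2 hx0
      have hsq : √x ^ 2 = x := Real.sq_sqrt hx0.le
      have hB : (2 - x) * (1 / (2 * √x) * eulerB x + √x * D) + √x * eulerB x
          = C * ((√x)⁻¹ * (1 - x) ^ (1/4 : ℝ)) := by
        rw [mul_left_comm, ← hW]
        field_simp
        rw [hsq]
        ring
      rw [hs] at hA
      simp only [id, Pi.add_apply, Pi.mul_apply]
      rw [hs, ← mul_div_assoc]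
      congr 1
      linear_combination α * hA + β * hB)
    (fun x hx => by
      have := hx.1
      have : 0 < 1 - x := by linarith [hx.2]
      have : 0 < 2 - x := by linarith [hx.2]
      positivity)
    (by simp [h0]) (by simp [incompleteA_one, h1]; norm_num) hχ
  rw [sub_eq_zero, div_eq_iff (hne χ (Ioo_subset_Icc_self hχ))] at key
  exact key

theorem Gamma_one_fourth_mul_Gamma_three_fourths :
    Real.Gamma (1/4) * Real.Gamma (3/4) = Real.pi * √2 := by
  have h := Real.Gamma_mul_Gamma_one_sub (1/4)
  rw [show (1 - 1/4 : ℝ) = 3/4 by norm_num, show Real.pi * (1/4) = Real.pi / 4 by ring,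
    Real.sin_pi_div_four] at h
  rw [h]
  have : √2 * √2 = 2 := Real.mul_self_sqrt (by norm_num)
  field_simp
  linarith

/-- For every χ ∈ (0,1),
(√(2√2+2)/π)·(Γ(3/4)/Γ(1/4))·A(χ) + (2√(1+√2)/π^{3/2})·χ^{−1/2}·B(χ)
  = √((√2+1)/(2π))·(2−χ)/√χ. -/
theorem stmt7 (χ : ℝ) (hχ : χ ∈ Set.Ioo (0 : ℝ) 1) :
    Real.sqrt (2 * Real.sqrt 2 + 2) / Real.pi * (Real.Gamma (3/4) / Real.Gamma (1/4)) * Aint χ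
      + 2 * Real.sqrt (1 + Real.sqrt 2) / Real.pi ^ ((3 : ℝ)/2) * χ ^ (-(1/2) : ℝ) * Bint χ
      = Real.sqrt ((Real.sqrt 2 + 1) / (2 * Real.pi)) * (2 - χ) / Real.sqrt χ := by
  have hπ := Real.pi_pos
  have hsπ : 0 < √Real.pi := Real.sqrt_pos.2 hπ
  have hππ : √Real.pi ^ 2 = Real.pi := Real.sq_sqrt hπ.le
  have h22 : √2 ^ 2 = (2 : ℝ) := Real.sq_sqrt (by norm_num)
  have hG1 : 0 < Real.Gamma (1/4) := Real.Gamma_pos_of_pos (by norm_num)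
  have hG3 : 0 < Real.Gamma (3/4) := Real.Gamma_pos_of_pos (by norm_num)
  have hrefl := Gamma_one_fourth_mul_Gamma_three_fourths
  have e1 : √(2 * √2 + 2) = √2 * √(1 + √2) := by
    rw [← Real.sqrt_mul (by norm_num)]; ring_nf
  have e2 : √((√2 + 1) / (2 * Real.pi)) = √(1 + √2) / (√2 * √Real.pi) := by
    rw [Real.sqrt_div (by positivity), Real.sqrt_mul (by norm_num), add_comm]
  have e3 : Real.pi ^ ((3 : ℝ)/2) = Real.pi * √Real.pi := by
    rw [Real.sqrt_eq_rpow, mul_comm, ← Real.rpow_add_one hπ.ne']; norm_num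
  have e4 : Real.Gamma (5/4) = 1/4 * Real.Gamma (1/4) := by
    rw [← Real.Gamma_add_one (by norm_num)]; norm_num
  have h := incompleteA_add_eulerB
    (α := √(2 * √2 + 2) / Real.pi * (Real.Gamma (3/4) / Real.Gamma (1/4)))
    (β := 2 * √(1 + √2) / Real.pi ^ ((3 : ℝ)/2))
    (γ := √((√2 + 1) / (2 * Real.pi)))
    (by
      rw [incompleteA_zero, Real.Gamma_one_half_eq, e1, e2]
      field_simp
      rw [hππ, h22, mul_comm])
    (by
      rw [eulerB_one, e2, e3, e4, mul_left_comm, mul_comm, mul_assoc, mul_assoc, hrefl]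
      field_simp
      rw [h22]
      norm_num) hχ
  have hs : χ ^ (-(1/2) : ℝ) = (√χ)⁻¹ := by rw [Real.rpow_neg hχ.1.le, Real.sqrt_eq_rpow]
  rw [Aint_eq hχ, Bint_eq hχ, hs, ← h]
  ring
end

section
/- On the open set Ω = {(a,b,c,d) ∈ ℝ⁴ : a < b < c < d}, let χ(a,b,c,d) := ((b−a)(d−c))/((d−b)(c−a)) ∈ (0,1) and define m(a,b,c,d) := (b−a)^{1/2}·(d−c)^{−1/2}·(d−a)^{−1/2}·(c−b)^{−1/2}·A(χ(a,b,c,d)). Then m is twice continuously differentiable on Ω and satisfies the partial differential equation (−1/(c−b)² − 1/(d−b)²)·m + (2/(a−b))·∂m/∂a + (2/(c−b))·∂m/∂c + (2/(d−b))·∂m/∂d − (2/3)·(1/(b−a))·∂m/∂b + (8/3)·∂²m/∂b² = 0 at every point of Ω. -/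
/-- The cross-ratio χ(a,b,c,d) = ((b−a)(d−c))/((d−b)(c−a)). -/
noncomputable def crossRatio (a b c d : ℝ) : ℝ := ((b - a) * (d - c)) / ((d - b) * (c - a))

/-- m(a,b,c,d) = (b-a)^(1/2) (d-c)^(-1/2) (d-a)^(-1/2) (c-b)^(-1/2) A(crossRatio a b c d). -/
noncomputable def mA (a b c d : ℝ) : ℝ :=
  (b - a) ^ ((1/2) : ℝ) * (d - c) ^ (-(1/2) : ℝ) * (d - a) ^ (-(1/2) : ℝ) *
    (c - b) ^ (-(1/2) : ℝ) * Aint (crossRatio a b c d)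

open Set Filter Topology MeasureTheory

/-- The Euler-type integral `∫_0^1 u^n (1-u)^{-3/4} (1-xu)^{-s} du`. -/
noncomputable def eulerInt (n : ℕ) (s x : ℝ) : ℝ :=
  ∫ u in (0 : ℝ)..1, u ^ n * (1 - u) ^ (-(3/4) : ℝ) * (1 - x * u) ^ (-s)

lemma intervalIntegrable_one_sub_rpow :
    IntervalIntegrable (fun u : ℝ => (1 - u) ^ (-(3/4) : ℝ)) volume 0 1 := by
  have h := (intervalIntegral.intervalIntegrable_rpow' (a := 0) (b := 1)
    (r := -(3/4)) (by norm_num)).comp_sub_left 1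
  simpa using h.symm

lemma one_sub_mul_ge {x y u : ℝ} (hx : 0 < x) (hxy : x ≤ y) (hu : u ∈ Ioc (0 : ℝ) 1) :
    1 - y ≤ 1 - x * u := by
  nlinarith [hu.1, hu.2]

lemma norm_euler_integrand_le (n : ℕ) {s x y u : ℝ} (hs : 0 ≤ s) (hx : 0 < x) (hxy : x ≤ y)
    (hy : y < 1) (hu : u ∈ Ioc (0 : ℝ) 1) :
    ‖u ^ n * (1 - u) ^ (-(3/4) : ℝ) * (1 - x * u) ^ (-s)‖
      ≤ (1 - u) ^ (-(3/4) : ℝ) * (1 - y) ^ (-s) := by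
  have hle := one_sub_mul_ge hx hxy hu
  have h1 : (0 : ℝ) ≤ (1 - u) ^ (-(3/4) : ℝ) := Real.rpow_nonneg (by linarith [hu.2]) _
  have h2 : 0 ≤ (1 - x * u) ^ (-s) := Real.rpow_nonneg (by linarith) _
  have h3 : (1 - x * u) ^ (-s) ≤ (1 - y) ^ (-s) :=
    Real.rpow_le_rpow_of_nonpos (by linarith) hle (by linarith)
  have h4 : u ^ n ≤ 1 := pow_le_one₀ hu.1.le hu.2
  have h5 : 0 ≤ u ^ n := pow_nonneg hu.1.le n
  rw [Real.norm_of_nonneg (by positivity)]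
  gcongr
  exact mul_le_of_le_one_left h1 h4

lemma measurable_euler_integrand (n : ℕ) (s x : ℝ) :
    Measurable fun u : ℝ => u ^ n * (1 - u) ^ (-(3/4) : ℝ) * (1 - x * u) ^ (-s) := by
  fun_prop

lemma intervalIntegrable_euler_integrand (n : ℕ) {s x : ℝ} (hs : 0 ≤ s) (hx : x ∈ Ioo (0 : ℝ) 1) :
    IntervalIntegrable (fun u : ℝ => u ^ n * (1 - u) ^ (-(3/4) : ℝ) * (1 - x * u) ^ (-s))
      volume 0 1 := by
  refine (intervalIntegrable_one_sub_rpow.mul_const ((1 - x) ^ (-s))).mono_fun'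
    (measurable_euler_integrand n s x).aestronglyMeasurable ?_
  rw [uIoc_of_le zero_le_one]
  exact (ae_restrict_mem measurableSet_Ioc).mono fun u hu =>
    norm_euler_integrand_le n hs hx.1 le_rfl hx.2 hu

lemma hasDerivAt_eulerInt (n : ℕ) {s x : ℝ} (hs : 0 ≤ s) (hx : x ∈ Ioo (0 : ℝ) 1) :
    HasDerivAt (eulerInt n s) (s * eulerInt (n + 1) (s + 1) x) x := by
  obtain ⟨y, hxy, hy⟩ := exists_between hx.2
  have key := (intervalIntegral.hasDerivAt_integral_of_dominated_loc_of_deriv_le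
    (μ := volume) (a := 0) (b := 1) (x₀ := x) (s := Ioo 0 y)
    (F := fun x u => u ^ n * (1 - u) ^ (-(3/4) : ℝ) * (1 - x * u) ^ (-s))
    (F' := fun x u => s * (u ^ (n + 1) * (1 - u) ^ (-(3/4) : ℝ) * (1 - x * u) ^ (-(s + 1))))
    (bound := fun u => s * ((1 - u) ^ (-(3/4) : ℝ) * (1 - y) ^ (-(s + 1))))
    (Ioo_mem_nhds hx.1 hxy)
    (Eventually.of_forall fun z => (measurable_euler_integrand n s z).aestronglyMeasurable)
    (intervalIntegrable_euler_integrand n hs hx)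
    ((measurable_euler_integrand (n + 1) (s + 1) x).const_mul s).aestronglyMeasurable
    ?_ ((intervalIntegrable_one_sub_rpow.mul_const _).const_mul _) ?_).2
  · rw [intervalIntegral.integral_const_mul] at key
    exact key
  · refine Eventually.of_forall fun u hu z hz => ?_
    rw [uIoc_of_le zero_le_one] at hu
    rw [norm_mul, Real.norm_of_nonneg hs]
    exact mul_le_mul_of_nonneg_left
      (norm_euler_integrand_le (n + 1) (by linarith) hz.1 hz.2.le hy hu) hs
  · refine Eventually.of_forall fun u hu z hz => ?_
    rw [uIoc_of_le zero_le_one] at hu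
    have hpos : 0 < 1 - z * u := by linarith [one_sub_mul_ge hz.1 hz.2.le hu]
    have h1 : HasDerivAt (fun z : ℝ => 1 - z * u) (-u) z := by
      simpa using ((hasDerivAt_id z).mul_const u).const_sub 1
    have h2 := (h1.rpow_const (p := -s) (Or.inl hpos.ne')).const_mul
      (u ^ n * (1 - u) ^ (-(3/4) : ℝ))
    refine h2.congr_deriv ?_
    rw [show -s - 1 = -(s + 1) by ring]
    ring

lemma contDiffOn_eulerInt (k n : ℕ) {s : ℝ} (hs : 0 ≤ s) :
    ContDiffOn ℝ k (eulerInt n s) (Ioo 0 1) := by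
  induction k generalizing n s with
  | zero =>
    exact contDiffOn_zero.2 fun x hx =>
      (hasDerivAt_eulerInt n hs hx).continuousAt.continuousWithinAt
  | succ k ih =>
    push_cast
    rw [contDiffOn_succ_iff_deriv_of_isOpen isOpen_Ioo]
    refine ⟨fun x hx => (hasDerivAt_eulerInt n hs hx).differentiableAt.differentiableWithinAt,
      by simp, ?_⟩
    exact (contDiffOn_const.mul (ih (n + 1) (s := s + 1) (by linarith))).congr fun x hx =>
      (hasDerivAt_eulerInt n hs hx).deriv

/-- The hypergeometric equation with parameters `(3/4, 2; 9/4)`. -/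
lemma eulerInt_ode {x : ℝ} (hx : x ∈ Ioo (0 : ℝ) 1) :
    x * (1 - x) * (21/16 * eulerInt 3 (11/4) x)
      + (9/4 - 15/4 * x) * (3/4 * eulerInt 2 (7/4) x) - 3/2 * eulerInt 1 (3/4) x = 0 := by
  have i3 := intervalIntegrable_euler_integrand 3 (s := 11/4) (by norm_num) hx
  have i2 := intervalIntegrable_euler_integrand 2 (s := 7/4) (by norm_num) hx
  have i1 := intervalIntegrable_euler_integrand 1 (s := 3/4) (by norm_num) hx
  have hint := ((i3.const_mul (x * (1 - x) * (21/16))).add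
    (i2.const_mul ((9/4 - 15/4 * x) * (3/4)))).sub (i1.const_mul (3/2))
  have hpos : ∀ u ∈ Icc (0 : ℝ) 1, 0 < 1 - x * u := fun u hu => by
    nlinarith [hu.1, hu.2, hx.1, hx.2]
  have ftc := intervalIntegral.integral_eq_sub_of_hasDerivAt_of_le (a := 0) (b := 1)
    (f := fun u : ℝ => -(3/4) * (u ^ 2 * (1 - u) ^ (1/4 : ℝ) * (1 - x * u) ^ (-(7/4) : ℝ)))
    zero_le_one ?_ ?_ hint
  · rw [intervalIntegral.integral_sub ((i3.const_mul _).add (i2.const_mul _)) (i1.const_mul _),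
      intervalIntegral.integral_add (i3.const_mul _) (i2.const_mul _)] at ftc
    simp only [intervalIntegral.integral_const_mul] at ftc
    have h0 : (0 : ℝ) ^ (1/4 : ℝ) = 0 := Real.zero_rpow (by norm_num)
    simp only [sub_self, h0] at ftc
    unfold eulerInt
    linear_combination ftc
  · refine continuousOn_const.mul (((by fun_prop : ContinuousOn _ _).mul ?_).mul ?_)
    · exact ContinuousOn.rpow_const (by fun_prop) fun u _ => Or.inr (by norm_num)
    · exact ContinuousOn.rpow_const (by fun_prop) fun u hu => Or.inl (hpos u hu).ne'
  · intro u hu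
    have hw := hpos u ⟨hu.1.le, hu.2.le⟩
    have hv : 0 < 1 - u := by linarith [hu.2]
    have d1 : HasDerivAt (fun u : ℝ => 1 - u) (-1) u := by
      simpa using (hasDerivAt_id u).const_sub 1
    have d2 : HasDerivAt (fun u : ℝ => 1 - x * u) (-x) u := by
      simpa using ((hasDerivAt_id u).const_mul x).const_sub 1
    have d := (((hasDerivAt_pow 2 u).mul (d1.rpow_const (p := 1/4) (Or.inl hv.ne'))).mul
      (d2.rpow_const (p := -(7/4)) (Or.inl hw.ne'))).const_mul (-(3/4))
    refine d.congr_deriv ?_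
    have e1 : (1 - u) ^ (1/4 : ℝ) = (1 - u) * (1 - u) ^ (-(3/4) : ℝ) := by
      rw [← Real.rpow_one_add' hv.le (by norm_num)]; norm_num
    have e2 : (1 - x * u) ^ (-(7/4) : ℝ) = (1 - x * u) * (1 - x * u) ^ (-(11/4) : ℝ) := by
      rw [← Real.rpow_one_add' hw.le (by norm_num)]; norm_num
    have e3 : (1 - x * u) ^ (-(3/4) : ℝ) = (1 - x * u) * (1 - x * u) ^ (-(7/4) : ℝ) := by
      rw [← Real.rpow_one_add' hw.le (by norm_num)]; norm_num
    simp only [Pi.mul_apply]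
    rw [show (1/4 - 1 : ℝ) = -(3/4) by norm_num, show (-(7/4) - 1 : ℝ) = -(11/4) by norm_num,
      e3, e2, e1]
    push_cast
    ring

lemma Aint_eq_eulerInt {χ : ℝ} (h : χ ∈ Ioo (0 : ℝ) 1) :
    Aint χ = (1 - χ) ^ (5/4 : ℝ) * eulerInt 1 (3/4) (1 - χ) := by
  have hx : 0 < 1 - χ := by linarith [h.2]
  have hsub := intervalIntegral.mul_integral_comp_sub_mul (a := 0) (b := 1) (c := 1 - χ) (d := 1)
    (f := fun ζ : ℝ => (1 - ζ) * ζ ^ (-(3/4) : ℝ) * (ζ - χ) ^ (-(3/4) : ℝ))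
  have e : (1 : ℝ) - (1 - χ) * 1 = χ := by ring
  rw [e, mul_zero, sub_zero] at hsub
  rw [Aint, ← hsub, eulerInt, ← intervalIntegral.integral_const_mul,
    ← intervalIntegral.integral_const_mul]
  refine intervalIntegral.integral_congr fun u hu => ?_
  rw [uIcc_of_le zero_le_one] at hu
  have hv : 0 ≤ 1 - u := by linarith [hu.2]
  have e1 : 1 - (1 - χ) * u - χ = (1 - χ) * (1 - u) := by ring
  have e2 : (1 - χ) ^ (5/4 : ℝ) = (1 - χ) * (1 - χ) * (1 - χ) ^ (-(3/4) : ℝ) := by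
    rw [mul_assoc, ← Real.rpow_one_add' hx.le (by norm_num),
      ← Real.rpow_one_add' hx.le (by norm_num)]
    norm_num
  simp only [e1, Real.mul_rpow hx.le hv, e2]
  ring

lemma contDiffOn_Aint : ContDiffOn ℝ 2 Aint (Ioo 0 1) := by
  have h1 : ContDiffOn ℝ 2 (fun χ : ℝ => (1 - χ) ^ (5/4 : ℝ)) (Ioo 0 1) :=
    (contDiffOn_const.sub contDiffOn_id).rpow_const_of_ne fun χ hχ => by
      simp only [id]; linarith [hχ.2]
  have h2 : ContDiffOn ℝ 2 (fun χ : ℝ => eulerInt 1 (3/4) (1 - χ)) (Ioo 0 1) :=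
    ContDiffOn.comp (contDiffOn_eulerInt 2 1 (by norm_num))
      (contDiffOn_const.sub contDiffOn_id) fun χ hχ =>
        ⟨by linarith [hχ.2], by linarith [hχ.1]⟩
  exact (h1.mul h2).congr fun χ hχ => Aint_eq_eulerInt hχ

lemma exists_hasDerivAt_Aint : ∃ A₁ A₂ : ℝ → ℝ, ∀ χ ∈ Ioo (0 : ℝ) 1,
    HasDerivAt Aint (A₁ χ) χ ∧ HasDerivAt A₁ (A₂ χ) χ ∧
      χ * (1 - χ) * A₂ χ + (3/2 - 5/4 * χ) * A₁ χ + 3/8 * Aint χ = 0 := by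
  have hp (p : ℝ) {χ : ℝ} (hχ : χ ∈ Ioo (0 : ℝ) 1) :
      HasDerivAt (fun χ : ℝ => (1 - χ) ^ p) (-(p * (1 - χ) ^ (p - 1))) χ := by
    have d : HasDerivAt (fun χ : ℝ => 1 - χ) (-1) χ := by
      simpa using (hasDerivAt_id χ).const_sub 1
    refine (d.rpow_const (p := p) (Or.inl (by linarith [hχ.2]))).congr_deriv ?_
    ring
  have hJ (n : ℕ) {s χ : ℝ} (hs : 0 ≤ s) (hχ : χ ∈ Ioo (0 : ℝ) 1) :
      HasDerivAt (fun χ : ℝ => eulerInt n s (1 - χ))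
        (-(s * eulerInt (n + 1) (s + 1) (1 - χ))) χ := by
    have d : HasDerivAt (fun χ : ℝ => 1 - χ) (-1) χ := by
      simpa using (hasDerivAt_id χ).const_sub 1
    refine (HasDerivAt.comp χ (hasDerivAt_eulerInt n hs (x := 1 - χ)
      ⟨by linarith [hχ.2], by linarith [hχ.1]⟩) d).congr_deriv ?_
    ring
  refine ⟨fun χ => -(5/4 * (1 - χ) ^ (5/4 - 1 : ℝ)) * eulerInt 1 (3/4) (1 - χ)
      + (1 - χ) ^ (5/4 : ℝ) * -(3/4 * eulerInt (1 + 1) (3/4 + 1) (1 - χ)), _, fun χ hχ =>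
      ⟨?_, (((hp (5/4 - 1) hχ).const_mul (5/4)).neg.mul (hJ 1 (by norm_num) hχ)).add
        ((hp (5/4) hχ).mul ((hJ (1 + 1) (by norm_num) hχ).const_mul (3/4)).neg), ?_⟩⟩
  · refine ((hp (5/4) hχ).mul (hJ 1 (s := 3/4) (by norm_num) hχ)).congr_of_eventuallyEq ?_
    filter_upwards [isOpen_Ioo.mem_nhds hχ] with t ht using Aint_eq_eulerInt ht
  · have ode := eulerInt_ode (x := 1 - χ) ⟨by linarith [hχ.2], by linarith [hχ.1]⟩
    have hx : 0 < 1 - χ := by linarith [hχ.2]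
    rw [Aint_eq_eulerInt hχ]
    have e1 : (1 - χ) ^ (5/4 : ℝ) = (1 - χ) * (1 - χ) * (1 - χ) ^ (-(3/4) : ℝ) := by
      rw [mul_assoc, ← Real.rpow_one_add' hx.le (by norm_num),
        ← Real.rpow_one_add' hx.le (by norm_num)]
      norm_num
    have e2 : (1 - χ) ^ (1/4 : ℝ) = (1 - χ) * (1 - χ) ^ (-(3/4) : ℝ) := by
      rw [← Real.rpow_one_add' hx.le (by norm_num)]
      norm_num
    norm_num at ode e1 e2 ⊢
    rw [e1, e2]
    linear_combination (1 - χ) ^ 2 * (1 - χ) ^ (-(3/4) : ℝ) * ode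

/-- The factor multiplying `Aint (crossRatio a b c d)` in `mA a b c d`. -/
noncomputable def prefactor (a b c d : ℝ) : ℝ :=
  (b - a) ^ ((1/2) : ℝ) * (d - c) ^ (-(1/2) : ℝ) * (d - a) ^ (-(1/2) : ℝ) *
    (c - b) ^ (-(1/2) : ℝ)

lemma crossRatio_mem_Ioo {a b c d : ℝ} (hab : a < b) (hbc : b < c) (hcd : c < d) :
    crossRatio a b c d ∈ Ioo (0 : ℝ) 1 := by
  have h1 : 0 < b - a := by linarith
  have h2 : 0 < d - c := by linarith
  have h3 : 0 < d - b := by linarith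
  have h4 : 0 < c - a := by linarith
  refine ⟨by unfold crossRatio; positivity, ?_⟩
  rw [crossRatio, div_lt_one (by positivity)]
  nlinarith [mul_pos (sub_pos.2 hbc) (sub_pos.2 (hab.trans (hbc.trans hcd)))]

lemma hasDerivAt_rpow_eq_mul {f : ℝ → ℝ} {f' t : ℝ} (p : ℝ) (hf : HasDerivAt f f' t)
    (h : 0 < f t) : HasDerivAt (fun t => f t ^ p) (f t ^ p * (p * (f' / f t))) t := by
  refine (hf.rpow_const (p := p) (Or.inl h.ne')).congr_deriv ?_
  rw [Real.rpow_sub_one h.ne']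
  ring

section Curve

variable {α β γ δ : ℝ → ℝ} {α' β' γ' δ' t : ℝ}

lemma hasDerivAt_prefactor_comp (hα : HasDerivAt α α' t) (hβ : HasDerivAt β β' t)
    (hγ : HasDerivAt γ γ' t) (hδ : HasDerivAt δ δ' t)
    (h₁ : α t < β t) (h₂ : β t < γ t) (h₃ : γ t < δ t) :
    HasDerivAt (fun t => prefactor (α t) (β t) (γ t) (δ t))
      (prefactor (α t) (β t) (γ t) (δ t) *
        (1/2 * ((β' - α') / (β t - α t) - (δ' - γ') / (δ t - γ t)
          - (δ' - α') / (δ t - α t) - (γ' - β') / (γ t - β t)))) t := by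
  have d1 := hasDerivAt_rpow_eq_mul (1/2) (hβ.sub hα) (sub_pos.2 h₁)
  have d2 := hasDerivAt_rpow_eq_mul (-(1/2)) (hδ.sub hγ) (sub_pos.2 h₃)
  have d3 := hasDerivAt_rpow_eq_mul (-(1/2)) (hδ.sub hα) (sub_pos.2 (h₁.trans (h₂.trans h₃)))
  have d4 := hasDerivAt_rpow_eq_mul (-(1/2)) (hγ.sub hβ) (sub_pos.2 h₂)
  refine (((d1.mul d2).mul d3).mul d4).congr_deriv ?_
  simp only [prefactor, Pi.mul_apply, Pi.sub_apply]
  ring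

lemma hasDerivAt_crossRatio_comp (hα : HasDerivAt α α' t) (hβ : HasDerivAt β β' t)
    (hγ : HasDerivAt γ γ' t) (hδ : HasDerivAt δ δ' t)
    (h₁ : α t < β t) (h₂ : β t < γ t) (h₃ : γ t < δ t) :
    HasDerivAt (fun t => crossRatio (α t) (β t) (γ t) (δ t))
      (crossRatio (α t) (β t) (γ t) (δ t) *
        ((β' - α') / (β t - α t) + (δ' - γ') / (δ t - γ t)
          - (δ' - β') / (δ t - β t) - (γ' - α') / (γ t - α t))) t := by
  have n1 : β t - α t ≠ 0 := (sub_pos.2 h₁).ne'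
  have n2 : δ t - γ t ≠ 0 := (sub_pos.2 h₃).ne'
  have n3 : δ t - β t ≠ 0 := (sub_pos.2 (h₂.trans h₃)).ne'
  have n4 : γ t - α t ≠ 0 := (sub_pos.2 (h₁.trans h₂)).ne'
  refine (((hβ.sub hα).mul (hδ.sub hγ)).div ((hδ.sub hβ).mul (hγ.sub hα))
    (mul_ne_zero n3 n4)).congr_deriv ?_
  simp only [crossRatio, Pi.mul_apply, Pi.sub_apply]
  field_simp
  ring

lemma hasDerivAt_mA_comp {A₁ : ℝ → ℝ} (hA : ∀ χ ∈ Ioo (0 : ℝ) 1, HasDerivAt Aint (A₁ χ) χ)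
    (hα : HasDerivAt α α' t) (hβ : HasDerivAt β β' t)
    (hγ : HasDerivAt γ γ' t) (hδ : HasDerivAt δ δ' t)
    (h₁ : α t < β t) (h₂ : β t < γ t) (h₃ : γ t < δ t) :
    HasDerivAt (fun t => mA (α t) (β t) (γ t) (δ t))
      (prefactor (α t) (β t) (γ t) (δ t) *
        (1/2 * ((β' - α') / (β t - α t) - (δ' - γ') / (δ t - γ t)
            - (δ' - α') / (δ t - α t) - (γ' - β') / (γ t - β t))
          * Aint (crossRatio (α t) (β t) (γ t) (δ t))
        + A₁ (crossRatio (α t) (β t) (γ t) (δ t)) * (crossRatio (α t) (β t) (γ t) (δ t) *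
          ((β' - α') / (β t - α t) + (δ' - γ') / (δ t - γ t)
            - (δ' - β') / (δ t - β t) - (γ' - α') / (γ t - α t))))) t := by
  refine ((hasDerivAt_prefactor_comp hα hβ hγ hδ h₁ h₂ h₃).mul
    ((hA _ (crossRatio_mem_Ioo h₁ h₂ h₃)).comp t
      (hasDerivAt_crossRatio_comp hα hβ hγ hδ h₁ h₂ h₃))).congr_deriv ?_
  simp only [Function.comp_apply]
  ring

end Curve

lemma hasDerivAt_deriv_mA {A₁ A₂ : ℝ → ℝ} (hA : ∀ χ ∈ Ioo (0 : ℝ) 1, HasDerivAt Aint (A₁ χ) χ)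
    (hA₁ : ∀ χ ∈ Ioo (0 : ℝ) 1, HasDerivAt A₁ (A₂ χ) χ)
    {a b c d : ℝ} (hab : a < b) (hbc : b < c) (hcd : c < d) :
    HasDerivAt (deriv fun t => mA a t c d)
      (prefactor a b c d *
        ((1/2 * (1 / (b - a) + 1 / (c - b))) *
          (1/2 * (1 / (b - a) + 1 / (c - b)) * Aint (crossRatio a b c d)
            + A₁ (crossRatio a b c d) *
              (crossRatio a b c d * (1 / (b - a) + 1 / (d - b))))
        + (1/2 * (-1 / (b - a) ^ 2 + 1 / (c - b) ^ 2) * Aint (crossRatio a b c d)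
        + 1/2 * (1 / (b - a) + 1 / (c - b)) * (A₁ (crossRatio a b c d) *
            (crossRatio a b c d * (1 / (b - a) + 1 / (d - b))))
        + A₂ (crossRatio a b c d) * (crossRatio a b c d * (1 / (b - a) + 1 / (d - b))) ^ 2
        + A₁ (crossRatio a b c d) * (crossRatio a b c d *
            ((1 / (b - a) + 1 / (d - b)) ^ 2 + (-1 / (b - a) ^ 2 + 1 / (d - b) ^ 2)))))) b := by
  have n1 : b - a ≠ 0 := by linarith
  have n2 : c - b ≠ 0 := by linarith
  have n3 : d - b ≠ 0 := by linarith
  have hmem := crossRatio_mem_Ioo hab hbc hcd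
  have dP := hasDerivAt_prefactor_comp (hasDerivAt_const b a) (hasDerivAt_id' b)
    (hasDerivAt_const b c) (hasDerivAt_const b d) hab hbc hcd
  have dX := hasDerivAt_crossRatio_comp (hasDerivAt_const b a) (hasDerivAt_id' b)
    (hasDerivAt_const b c) (hasDerivAt_const b d) hab hbc hcd
  have dA := HasDerivAt.comp b (hA _ hmem) dX
  have dA₁ := HasDerivAt.comp b (hA₁ _ hmem) dX
  have r1 : HasDerivAt (fun t : ℝ => 1 / (t - a)) (-1 / (b - a) ^ 2) b := by
    simpa using ((hasDerivAt_id' b).sub_const a).fun_inv n1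
  have r2 : HasDerivAt (fun t : ℝ => 1 / (c - t)) (1 / (c - b) ^ 2) b := by
    simpa using ((hasDerivAt_id' b).const_sub c).fun_inv n2
  have r3 : HasDerivAt (fun t : ℝ => 1 / (d - t)) (1 / (d - b) ^ 2) b := by
    simpa using ((hasDerivAt_id' b).const_sub d).fun_inv n3
  have key := dP.mul ((((r1.add r2).const_mul (1/2)).mul dA).add (dA₁.mul (dX.mul (r1.add r3))))
  refine (key.congr_of_eventuallyEq ?_).congr_deriv ?_
  · filter_upwards [isOpen_Ioo.mem_nhds (show b ∈ Ioo a c from ⟨hab, hbc⟩)] with t ht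
    rw [(hasDerivAt_mA_comp hA (hasDerivAt_const t a) (hasDerivAt_id' t)
      (hasDerivAt_const t c) (hasDerivAt_const t d) ht.1 ht.2 hcd).deriv]
    simp only [Function.comp_apply, Pi.mul_apply, Pi.add_apply]
    ring
  · simp only [Function.comp_apply, Pi.mul_apply, Pi.add_apply]
    ring

lemma contDiffOn_mA :
    ContDiffOn ℝ 2 (fun p : ℝ × ℝ × ℝ × ℝ => mA p.1 p.2.1 p.2.2.1 p.2.2.2)
      {p : ℝ × ℝ × ℝ × ℝ | p.1 < p.2.1 ∧ p.2.1 < p.2.2.1 ∧ p.2.2.1 < p.2.2.2} := by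
  have hpow (f : ℝ × ℝ × ℝ × ℝ → ℝ) (hf : ContDiff ℝ 2 f) (r : ℝ)
      (h : ∀ p ∈ {p : ℝ × ℝ × ℝ × ℝ | p.1 < p.2.1 ∧ p.2.1 < p.2.2.1 ∧ p.2.2.1 < p.2.2.2},
        0 < f p) :
      ContDiffOn ℝ 2 (fun p => f p ^ r)
        {p : ℝ × ℝ × ℝ × ℝ | p.1 < p.2.1 ∧ p.2.1 < p.2.2.1 ∧ p.2.2.1 < p.2.2.2} :=
    hf.contDiffOn.rpow_const_of_ne fun p hp => (h p hp).ne'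
  refine ((((hpow _ (by fun_prop) _ ?_).mul (hpow _ (by fun_prop) _ ?_)).mul
    (hpow _ (by fun_prop) _ ?_)).mul (hpow _ (by fun_prop) _ ?_)).mul
    (contDiffOn_Aint.comp (ContDiffOn.div (ContDiff.contDiffOn (by fun_prop))
      (ContDiff.contDiffOn (by fun_prop)) ?_) ?_)
  any_goals rintro p ⟨h1, h2, h3⟩; linarith
  · rintro p ⟨h1, h2, h3⟩
    exact (mul_pos (by linarith) (by linarith)).ne'
  · rintro p ⟨h1, h2, h3⟩
    exact crossRatio_mem_Ioo h1 h2 h3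

/-- On Ω = {a < b < c < d}, the function m(a,b,c,d) is twice continuously
differentiable and satisfies
(−1/(c−b)² − 1/(d−b)²)·m + (2/(a−b))·∂m/∂a + (2/(c−b))·∂m/∂c + (2/(d−b))·∂m/∂d
  − (2/3)·(1/(b−a))·∂m/∂b + (8/3)·∂²m/∂b² = 0. -/
theorem stmt8 :
    ContDiffOn ℝ 2 (fun p : ℝ × ℝ × ℝ × ℝ => mA p.1 p.2.1 p.2.2.1 p.2.2.2)
      {p : ℝ × ℝ × ℝ × ℝ | p.1 < p.2.1 ∧ p.2.1 < p.2.2.1 ∧ p.2.2.1 < p.2.2.2} ∧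
    ∀ a b c d : ℝ, a < b → b < c → c < d →
      (-1 / (c - b) ^ 2 - 1 / (d - b) ^ 2) * mA a b c d
        + (2 / (a - b)) * deriv (fun t => mA t b c d) a
        + (2 / (c - b)) * deriv (fun t => mA a b t d) c
        + (2 / (d - b)) * deriv (fun t => mA a b c t) d
        - (2 / 3) * (1 / (b - a)) * deriv (fun t => mA a t c d) b
        + (8 / 3) * deriv (deriv (fun t => mA a t c d)) b = 0 := by
  refine ⟨contDiffOn_mA, fun a b c d hab hbc hcd => ?_⟩
  obtain ⟨A₁, A₂, hA⟩ := exists_hasDerivAt_Aint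
  have hA' := fun χ hχ => (hA χ hχ).1
  have da := (hasDerivAt_mA_comp hA' (hasDerivAt_id' a) (hasDerivAt_const a b)
    (hasDerivAt_const a c) (hasDerivAt_const a d) hab hbc hcd).deriv
  have db := (hasDerivAt_mA_comp hA' (hasDerivAt_const b a) (hasDerivAt_id' b)
    (hasDerivAt_const b c) (hasDerivAt_const b d) hab hbc hcd).deriv
  have dc := (hasDerivAt_mA_comp hA' (hasDerivAt_const c a) (hasDerivAt_const c b)
    (hasDerivAt_id' c) (hasDerivAt_const c d) hab hbc hcd).deriv
  have dd := (hasDerivAt_mA_comp hA' (hasDerivAt_const d a) (hasDerivAt_const d b)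
    (hasDerivAt_const d c) (hasDerivAt_id' d) hab hbc hcd).deriv
  have dbb := (hasDerivAt_deriv_mA hA' (fun χ hχ => (hA χ hχ).2.1) hab hbc hcd).deriv
  have ode := (hA _ (crossRatio_mem_Ioo hab hbc hcd)).2.2
  rw [da, db, dc, dd, dbb, show mA a b c d = prefactor a b c d * Aint (crossRatio a b c d) from rfl]
  generalize A₁ (crossRatio a b c d) = Y₁ at *
  generalize A₂ (crossRatio a b c d) = Y₂ at *
  generalize Aint (crossRatio a b c d) = Y at *
  generalize prefactor a b c d = P
  have n1 : b - a ≠ 0 := by linarith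
  have n1' : a - b ≠ 0 := by linarith
  have n2 : c - b ≠ 0 := by linarith
  have n3 : d - b ≠ 0 := by linarith
  have n4 : d - c ≠ 0 := by linarith
  have n5 : d - a ≠ 0 := by linarith
  have n6 : c - a ≠ 0 := by linarith
  have hχ : 1 - crossRatio a b c d = (c - b) * (d - a) / ((d - b) * (c - a)) := by
    rw [crossRatio]; field_simp; ring
  rw [hχ, crossRatio] at ode
  refine Eq.trans ?_ ((congrArg (P * (8/3 * ((d - c) * (d - a) /
    ((c - b) * (b - a) * (d - b) ^ 2))) * ·) ode).trans (mul_zero _))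
  rw [crossRatio]
  field_simp
  ring
end
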